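/- For every integer n ≥ 1 and every integer k with 1 ≤ k ≤ n, the number of type-B permutation tableaux of size n in which the k-th border step is a west step and the diagonal cell lying in the column corresponding to that west step contains a 1 equals |B_n|/2. -/

import Mathlib

/-- A type-B permutation tableau of size `n`, encoded via its border steps and filling.

Border steps are indexed by `Fin n` (index `i` is the `(i+1)`-th step from the
northeast corner); `west i = true` means the `(i+1)`-th step is a west step
(giving a column) and `west i = false` means it is a south step (giving a row
of the original, unshifted diagram).

Rows of the shifted diagram are also indexed by `Fin n`: a south step `r` indexes
the corresponding original row, and a west step `r` indexes the inserted diagonal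
row whose diagonal cell lies in the column of `r`.  The cell in row `r` and the
column of a west step `c` exists iff (`r` is south and `r < c`) or (`r` is west
and `r ≤ c`); in particular the diagonal cell of the column of `c` is `(c, c)`.
Columns are ordered left-to-right by decreasing step index, rows top-to-bottom as:
diagonal rows by decreasing step index, then original rows by increasing step index.

`filling r c = true` means the cell `(r, c)` contains a 1; `filling` is `false`
outside the cells of the diagram (field `support`).  The fields `col_one`,
`no_bad_zero` and `diag_zero` are the three defining conditions of a type-B
permutation tableau. -/
structure TypeBTableau (n : ℕ) where
  west : Fin n → Bool
  filling : Fin n → Fin n → Bool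
  support : ∀ r c : Fin n, filling r c = true →
    west c = true ∧ ((west r = false ∧ (r : ℕ) < (c : ℕ)) ∨ (west r = true ∧ (r : ℕ) ≤ (c : ℕ)))
  col_one : ∀ c : Fin n, west c = true → ∃ r : Fin n, filling r c = true
  no_bad_zero : ∀ r c : Fin n,
    (west c = true ∧ ((west r = false ∧ (r : ℕ) < (c : ℕ)) ∨ (west r = true ∧ (r : ℕ) ≤ (c : ℕ)))) →
    filling r c = false →
    ¬((∃ r' : Fin n,
        ((west r' = true ∧ west r = false) ∨
         (west r' = true ∧ west r = true ∧ (r : ℕ) < (r' : ℕ)) ∨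
         (west r' = false ∧ west r = false ∧ (r' : ℕ) < (r : ℕ))) ∧
        filling r' c = true) ∧
      (∃ c' : Fin n, (c : ℕ) < (c' : ℕ) ∧ filling r c' = true))
  diag_zero : ∀ j : Fin n, west j = true → filling j j = false →
    ∀ c : Fin n, filling j c = false

namespace TypeBTableau

noncomputable instance instFintype {n : ℕ} : Fintype (TypeBTableau n) :=
  Fintype.ofInjective (fun T => (T.west, T.filling)) (by
    rintro ⟨w1, f1, _, _, _, _⟩ ⟨w2, f2, _, _, _, _⟩ h
    simp only [Prod.mk.injEq] at h
    obtain ⟨h1, h2⟩ := h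
    subst h1; subst h2; rfl)

end TypeBTableau

open Finset

namespace TypeBTableau

/-- position key: smaller means higher row -/
def key {n : ℕ} (w : Fin n → Bool) (r : Fin n) : ℤ :=
  if w r = true then -(r : ℤ) - 1 else (r : ℤ)

theorem key_inj {n : ℕ} (w : Fin n → Bool) : Function.Injective (key w) := by
  intro a b h
  unfold key at h
  apply Fin.ext
  split_ifs at h <;> omega

theorem above_iff {n : ℕ} (w : Fin n → Bool) (r' r : Fin n) :
    ((w r' = true ∧ w r = false) ∨
         (w r' = true ∧ w r = true ∧ (r : ℕ) < (r' : ℕ)) ∨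
         (w r' = false ∧ w r = false ∧ (r' : ℕ) < (r : ℕ))) ↔ key w r' < key w r := by
  unfold key
  cases h1 : w r' <;> cases h2 : w r <;> simp <;> omega

/-- is a cell -/
def isCell {n : ℕ} (w : Fin n → Bool) (r c : Fin n) : Prop :=
  w c = true ∧ ((w r = false ∧ (r : ℕ) < (c : ℕ)) ∨ (w r = true ∧ (r : ℕ) ≤ (c : ℕ)))

theorem nbz {n : ℕ} (T : TypeBTableau n) (r c r' c' : Fin n) (h : isCell T.west r c)
    (h0 : T.filling r c = false) (hk : key T.west r' < key T.west r)
    (h1 : T.filling r' c = true) (hc : (c : ℕ) < c') : T.filling r c' = false := by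
  by_contra h2
  exact T.no_bad_zero r c h h0 ⟨⟨r', (above_iff _ _ _).2 hk, h1⟩, ⟨c', hc, by simpa using h2⟩⟩

/-- unrestricted row -/
def Unr {n : ℕ} (T : TypeBTableau n) (r : Fin n) : Prop :=
  (T.west r = true → T.filling r r = true) ∧
  ∀ c, isCell T.west r c → T.filling r c = false →
    ∀ r', key T.west r' < key T.west r → T.filling r' c = false

open Classical in
/-- set of unrestricted rows -/
noncomputable def U {n : ℕ} (T : TypeBTableau n) : Finset (Fin n) := Finset.univ.filter T.Unr

theorem mem_U {n : ℕ} (T : TypeBTableau n) (r : Fin n) : r ∈ T.U ↔ T.Unr r := by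
  simp [U]

theorem ext' {n : ℕ} {S T : TypeBTableau n} (h1 : S.west = T.west) (h2 : S.filling = T.filling) :
    S = T := by
  cases S; cases T; simp at h1 h2; subst h1; subst h2; rfl

/-- restriction -/
def restr {n : ℕ} (T : TypeBTableau (n+1)) : TypeBTableau n where
  west r := T.west r.castSucc
  filling r c := T.filling r.castSucc c.castSucc
  support r c h := by simpa using T.support _ _ h
  col_one c h := by
    obtain ⟨r, hr⟩ := T.col_one _ h
    induction r using Fin.lastCases with
    | last =>
      have := T.support _ _ hr
      have h3 := c.2
      simp at this
      omega
    | cast r => exact ⟨r, hr⟩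
  no_bad_zero r c h h0 := by
    rintro ⟨⟨r', hr', h1⟩, c', hc', h2⟩
    exact T.no_bad_zero r.castSucc c.castSucc (by simpa using h) h0
      ⟨⟨r'.castSucc, by simpa using hr', h1⟩, ⟨c'.castSucc, by simpa using hc', h2⟩⟩
  diag_zero j h h0 c := T.diag_zero _ h h0 _

/-- extension data validity -/
def Valid {n : ℕ} (T : TypeBTableau n) (p : Bool × Bool × Finset (Fin n)) : Prop :=
  p.2.2 ⊆ T.U ∧ (p.1 = false → p.2.1 = false ∧ p.2.2 = ∅) ∧
    (p.1 = true → p.2.1 = true ∨ p.2.2.Nonempty)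

/-- extended west -/
def eW {n : ℕ} (w : Fin n → Bool) (b : Bool) : Fin (n+1) → Bool :=
  Fin.lastCases b w

/-- extended filling -/
def eF {n : ℕ} (f : Fin n → Fin n → Bool) (d : Bool) (A : Finset (Fin n)) :
    Fin (n+1) → Fin (n+1) → Bool := fun r c =>
  Fin.lastCases (motive := fun _ => Bool)
    (Fin.lastCases (motive := fun _ => Bool) d (fun r => decide (r ∈ A)) r)
    (fun c => Fin.lastCases (motive := fun _ => Bool) false (fun r => f r c) r) c

section
variable {n : ℕ} (w : Fin n → Bool) (b : Bool) (f : Fin n → Fin n → Bool) (d : Bool)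
  (A : Finset (Fin n)) (r c : Fin n)
@[simp] theorem eW_last : eW w b (Fin.last n) = b := by simp [eW]
@[simp] theorem eW_cast : eW w b r.castSucc = w r := by simp [eW]
@[simp] theorem eF_ll : eF f d A (Fin.last n) (Fin.last n) = d := by simp [eF]
@[simp] theorem eF_cl : eF f d A r.castSucc (Fin.last n) = decide (r ∈ A) := by simp [eF]
@[simp] theorem eF_lc : eF f d A (Fin.last n) c.castSucc = false := by simp [eF]
@[simp] theorem eF_cc : eF f d A r.castSucc c.castSucc = f r c := by simp [eF]
@[simp] theorem key_cast : key (eW w b) r.castSucc = key w r := by simp [key]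
@[simp] theorem isCell_cc : isCell (eW w b) r.castSucc c.castSucc ↔ isCell w r c := by
  simp [isCell]
@[simp] theorem isCell_cl : isCell (eW w b) r.castSucc (Fin.last n) ↔ b = true := by
  have := r.2
  cases h : w r <;> simp [isCell, h]
@[simp] theorem isCell_lc : ¬ isCell (eW w b) (Fin.last n) c.castSucc := by
  have := c.2
  simp [isCell]
@[simp] theorem isCell_ll : isCell (eW w b) (Fin.last n) (Fin.last n) ↔ b = true := by
  simp [isCell]
theorem key_last_lt : key (eW w true) (Fin.last n) < key w r := by
  have := r.2
  simp only [key, eW_last, if_true, Fin.val_last]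
  split_ifs <;> omega
theorem key_lt_last : ¬ (key w r < key (eW w true) (Fin.last n)) := by
  have := key_last_lt w r
  omega
end

/-- extension -/
def extn {n : ℕ} (T : TypeBTableau n) (p : Bool × Bool × Finset (Fin n)) (hp : Valid T p) :
    TypeBTableau (n+1) where
  west := eW T.west p.1
  filling := eF T.filling p.2.1 p.2.2
  support r c := by
    change _ → isCell _ _ _
    obtain ⟨b, d, A⟩ := p
    obtain ⟨h1, h2, h3⟩ := hp
    simp only at h1 h2 h3 ⊢
    induction r using Fin.lastCases <;> induction c using Fin.lastCases <;> simp
    · rintro rfl; by_contra h; simp at h; simpa using (h2 h).1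
    · intro hr; by_contra h; simp at h; rw [(h2 h).2] at hr; simp at hr
    · exact T.support _ _
  col_one c := by
    obtain ⟨b, d, A⟩ := p
    obtain ⟨h1, h2, h3⟩ := hp
    simp only at h1 h2 h3 ⊢
    induction c using Fin.lastCases <;> simp
    · intro hb
      rcases h3 hb with h | ⟨r, h⟩
      · exact ⟨Fin.last n, by simpa using h⟩
      · exact ⟨r.castSucc, by simpa using h⟩
    · intro hc
      obtain ⟨r, hr⟩ := T.col_one _ hc
      exact ⟨r.castSucc, by simpa using hr⟩
  no_bad_zero r c := by
    change isCell _ _ _ → _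
    simp only [above_iff]
    rintro hcell h0 ⟨⟨r', hr', h1⟩, c', hc', h2⟩
    obtain ⟨b, d, A⟩ := p
    obtain ⟨hA, -, -⟩ := hp
    simp only at *
    induction c using Fin.lastCases with
    | last => simp at hc'; omega
    | cast c =>
      induction r using Fin.lastCases with
      | last => simp at hcell
      | cast r =>
        induction r' using Fin.lastCases with
        | last => simp at h1
        | cast r' =>
          simp at hcell h0 h1 hr'
          induction c' using Fin.lastCases with
          | last =>
            simp at h2
            have := ((T.mem_U r).1 (hA h2)).2 c hcell h0 r' hr'
            simp [this] at h1
          | cast c' =>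
            simp at h2 hc'
            have := T.nbz r c r' c' hcell h0 hr' h1 hc'
            simp [this] at h2
  diag_zero j hj h0 c := by
    obtain ⟨b, d, A⟩ := p
    obtain ⟨hA, -, -⟩ := hp
    simp only at *
    induction j using Fin.lastCases with
    | last =>
      induction c using Fin.lastCases <;> simp
      simpa using h0
    | cast j =>
      simp at hj h0
      induction c using Fin.lastCases <;> simp
      · intro h
        have := ((T.mem_U j).1 (hA h)).1 hj
        simp [this] at h0
      · exact T.diag_zero _ hj h0 _

/-- data extraction -/
def dat {n : ℕ} (T : TypeBTableau (n+1)) : Bool × Bool × Finset (Fin n) :=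
  (T.west (Fin.last n), T.filling (Fin.last n) (Fin.last n),
    Finset.univ.filter fun r : Fin n => T.filling r.castSucc (Fin.last n) = true)

theorem key_restr {n : ℕ} (T : TypeBTableau (n+1)) (r : Fin n) :
    key T.restr.west r = key T.west r.castSucc := by rfl

theorem dat_valid {n : ℕ} (T : TypeBTableau (n+1)) : Valid T.restr T.dat := by
  refine ⟨?_, ?_, ?_⟩
  · intro r hr
    simp [dat] at hr
    rw [mem_U]
    refine ⟨?_, ?_⟩
    · intro h
      by_contra h0
      have := T.diag_zero r.castSucc h (by simpa [restr] using h0) (Fin.last n)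
      simp [this] at hr
    · intro c hc h0 r' hk
      by_contra h1
      have := T.nbz r.castSucc c.castSucc r'.castSucc (Fin.last n) (by simpa [isCell, restr] using hc)
        h0 (by simpa [key_restr] using hk) (by simpa [restr] using h1) (by simp)
      simp [this] at hr
  · intro h
    simp only [dat] at h ⊢
    constructor
    · by_contra h1
      have := (T.support _ _ (by simpa using h1)).1
      simp [this] at h
    · ext r
      simp
      by_contra h1
      have := (T.support _ _ (by simpa using h1)).1
      simp [this] at h
  · intro h
    simp only [dat] at h ⊢
    obtain ⟨r, hr⟩ := T.col_one _ h
    induction r using Fin.lastCases with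
    | last => exact Or.inl hr
    | cast r => exact Or.inr ⟨r, by simpa using hr⟩

/-- the equivalence -/
def eqv (n : ℕ) : TypeBTableau (n+1) ≃ Σ T : TypeBTableau n, {p // Valid T p} where
  toFun T := ⟨T.restr, T.dat, T.dat_valid⟩
  invFun x := extn x.1 x.2.1 x.2.2
  left_inv T := by
    apply ext'
    · funext r
      induction r using Fin.lastCases <;> simp [extn, restr, dat]
    · funext r c
      induction r using Fin.lastCases <;> induction c using Fin.lastCases <;>
        simp [extn, restr, dat]
      by_contra h
      have := T.support _ _ (by simpa using Ne.symm h)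
      simp at this
      omega
  right_inv := by
    rintro ⟨T, ⟨⟨b, d, A⟩, hp⟩⟩
    have h1 : (extn T (b, d, A) hp).restr = T := by
      apply ext'
      · funext r; simp [extn, restr]
      · funext r c; simp [extn, restr]
    have h2 : (extn T (b, d, A) hp).dat = (b, d, A) := by
      simp [dat, extn]
    refine Sigma.ext h1 ?_
    simp only
    rw [Subtype.heq_iff_coe_eq]
    · exact h2
    · intro x; rw [h1]

open Classical in
theorem sum_ext {n : ℕ} (F : TypeBTableau (n+1) → ℕ) :
    ∑ T, F T = ∑ T : TypeBTableau n, ∑ p : {p // Valid T p}, F (extn T p.1 p.2) := by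
  rw [← (eqv n).symm.sum_comp, Fintype.sum_sigma]
  rfl

/-- set retained in the 0-diagonal case -/
noncomputable def ret {n : ℕ} (w : Fin n → Bool) (V A : Finset (Fin n)) : Finset (Fin n) :=
  V.filter fun r => r ∈ A ∨ ∀ r' ∈ A, ¬ key w r' < key w r

theorem U_cast {n : ℕ} (T : TypeBTableau n) (p) (hp : Valid T p) (r : Fin n) :
    r.castSucc ∈ (extn T p hp).U ↔ r ∈ T.U ∧ (p.1 = true → (r ∈ p.2.2 ∨
      (p.2.1 = false ∧ ∀ r' ∈ p.2.2, ¬ key T.west r' < key T.west r))) := by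
  obtain ⟨b, d, A⟩ := p
  simp only [mem_U, Unr, extn, Fin.forall_fin_succ', eW_cast, eF_cc, isCell_cc, isCell_cl,
    key_cast, eF_cl, eF_lc, eF_ll, implies_true, and_true]
  rw [and_assoc]
  refine and_congr_right fun _ => and_congr_right fun _ => ?_
  cases b
  · simp
  · have := key_last_lt T.west r
    simp only [this, decide_eq_false_iff_not, forall_true_left]
    by_cases hr : r ∈ A
    · simp [hr]
    · simp only [hr, not_false_eq_true, forall_true_left, false_or]
      rw [and_comm]
      refine and_congr_right fun _ => forall_congr' fun _ => ?_
      tauto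

theorem U_last {n : ℕ} (T : TypeBTableau n) (p) (hp : Valid T p) :
    Fin.last n ∈ (extn T p hp).U ↔ (p.1 = true → p.2.1 = true) := by
  obtain ⟨b, d, A⟩ := p
  simp only [mem_U, Unr, extn, Fin.forall_fin_succ', eW_last, isCell_lc, isCell_ll,
    key_cast, eF_cl, eF_lc, eF_ll, implies_true, and_true]
  cases b <;> cases d <;> simp

open Classical in
theorem card_succ {n : ℕ} (S : Finset (Fin (n+1))) :
    S.card = (Finset.univ.filter fun r : Fin n => r.castSucc ∈ S).card
      + if Fin.last n ∈ S then 1 else 0 := by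
  have : S.card = ∑ r : Fin (n+1), if r ∈ S then 1 else 0 := by simp
  rw [this, Fin.sum_univ_castSucc, Finset.card_filter]

theorem card_U_S {n : ℕ} (T : TypeBTableau n) (d A) (hp : Valid T (false, d, A)) :
    (extn T _ hp).U.card = T.U.card + 1 := by
  classical
  rw [card_succ]; simp [U_cast, U_last]

theorem card_U_1 {n : ℕ} (T : TypeBTableau n) (A) (hp : Valid T (true, true, A)) :
    (extn T _ hp).U.card = A.card + 1 := by
  classical
  rw [card_succ]
  have := hp.1
  simp [U_cast, U_last]
  congr 1; ext r; simp; exact fun h => this h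

theorem card_U_0 {n : ℕ} (T : TypeBTableau n) (A) (hp : Valid T (true, false, A)) :
    (extn T _ hp).U.card = (ret T.west T.U A).card := by
  classical
  rw [card_succ]
  simp [U_cast, U_last, ret]
  congr 1; ext r; simp

open Classical in
theorem sum_ret {n : ℕ} (w : Fin n → Bool) (x : ℕ) (V : Finset (Fin n)) :
    (∑ A ∈ V.powerset, x ^ (ret w V A).card) + x ^ (V.card + 1)
      = x * (1 + x) ^ V.card + x ^ V.card := by
  induction V using Finset.induction_on_min_value (key w) with
  | empty => simp [ret]; try omega
  | insert m V hm hmin ih =>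
    have hlt : ∀ r ∈ V, key w m < key w r := fun r hr =>
      lt_of_le_of_ne (hmin r hr) fun h => hm (key_inj w h ▸ hr)
    rw [Finset.sum_powerset_insert hm, Finset.card_insert_of_notMem hm]
    have e1 : ∀ A ∈ V.powerset, x ^ (ret w (insert m V) A).card = x * x ^ (ret w V A).card := by
      intro A hA
      rw [Finset.mem_powerset] at hA
      have : ret w (insert m V) A = insert m (ret w V A) := by
        unfold ret
        rw [Finset.filter_insert, if_pos]
        right
        intro r' hr'
        have := hlt r' (hA hr')
        omega
      rw [this, Finset.card_insert_of_notMem (by simp [ret, hm]), pow_succ']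
    have e2 : ∀ A ∈ V.powerset, x ^ (ret w (insert m V) (insert m A)).card = x * x ^ A.card := by
      intro A hA
      rw [Finset.mem_powerset] at hA
      have : ret w (insert m V) (insert m A) = insert m A := by
        ext r
        simp only [ret, Finset.mem_filter, Finset.mem_insert]
        constructor
        · rintro ⟨h1 | h1, h2⟩
          · exact Or.inl h1
          · rcases h2 with h2 | h2
            · exact h2
            · exact absurd (hlt r h1) (h2 m (Or.inl rfl))
        · rintro (h | h)
          · exact ⟨Or.inl h, Or.inl (Or.inl h)⟩
          · exact ⟨Or.inr (hA h), Or.inl (Or.inr h)⟩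
      rw [this, Finset.card_insert_of_notMem (fun h => hm (hA h)), pow_succ']
    rw [Finset.sum_congr rfl e1, Finset.sum_congr rfl e2, ← Finset.mul_sum, ← Finset.mul_sum]
    have e3 : ∑ A ∈ V.powerset, x ^ A.card = (1 + x) ^ V.card := by
      have := Finset.sum_pow_mul_eq_add_pow x 1 V
      simpa [add_comm] using this
    rw [e3]
    have : x * ((∑ A ∈ V.powerset, x ^ (ret w V A).card) + x ^ (V.card + 1))
      = x * (x * (1 + x) ^ V.card + x ^ V.card) := by rw [ih]
    ring_nf at this ⊢
    linarith

open Classical in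
theorem sum_valid {n : ℕ} (T : TypeBTableau n) (F : TypeBTableau (n+1) → ℕ)
    (G : Bool × Bool × Finset (Fin n) → ℕ)
    (h : ∀ p hp, F (extn T p hp) = G p) :
    ∑ p : {p // Valid T p}, F (extn T p.1 p.2) =
      G (false, false, ∅) + ∑ A ∈ T.U.powerset, G (true, true, A)
        + ∑ A ∈ T.U.powerset.erase ∅, G (true, false, A) := by
  have : ∑ p : {p // Valid T p}, F (extn T p.1 p.2) = ∑ p, if Valid T p then G p else 0 := by
    rw [← Finset.sum_filter]
    rw [Finset.sum_congr rfl (fun p _ => h p.1 p.2)]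
    exact (Finset.sum_subtype _ (by simp) G).symm
  rw [this]
  simp only [Fintype.sum_prod_type, Fintype.sum_bool]
  have a1 : ∀ A, Valid T (true, true, A) ↔ A ∈ T.U.powerset := by simp [Valid]
  have a2 : ∀ A, Valid T (true, false, A) ↔ A ∈ T.U.powerset.erase ∅ := by
    simp [Valid, Finset.nonempty_iff_ne_empty, and_comm]
  have a3 : ∀ A, ¬ Valid T (false, true, A) := by simp [Valid]
  have a4 : ∀ A, Valid T (false, false, A) ↔ A = ∅ := by
    intro A; simp [Valid]; rintro rfl; simp
  simp only [a1, a2, a3, a4, if_false, Finset.sum_const_zero, zero_add, Finset.sum_ite_eq',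
    Finset.mem_univ, if_true, Finset.sum_ite_mem, Finset.univ_inter]
  ring

open Classical in
theorem sum_all {n : ℕ} (T : TypeBTableau n) (x : ℕ) :
    ∑ p : {p // Valid T p}, x ^ (extn T p.1 p.2).U.card = 2 * x * (1 + x) ^ T.U.card := by
  classical
  have := sum_valid T (fun S => x ^ S.U.card) (fun p => match p with
    | (false, _, _) => x ^ (T.U.card + 1)
    | (true, true, A) => x ^ (A.card + 1)
    | (true, false, A) => x ^ (ret T.west T.U A).card) (by
      rintro ⟨b, d, A⟩ hp
      cases b
      · simp [card_U_S]
      · cases d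
        · simp [card_U_0]
        · simp [card_U_1])
  simp only at this
  refine this.trans ?_
  have h1 := sum_ret T.west x T.U
  rw [← Finset.add_sum_erase _ _ (Finset.empty_mem_powerset T.U)] at h1
  have h2 : ret T.west T.U ∅ = T.U := by simp [ret]
  rw [h2] at h1
  have h3 : ∑ A ∈ T.U.powerset, x ^ (A.card + 1) = x * (1 + x) ^ T.U.card := by
    have := Finset.sum_pow_mul_eq_add_pow x 1 T.U
    simp only [one_pow, mul_one] at this
    simp only [pow_succ', ← Finset.mul_sum, this, add_comm]
  rw [h3]
  linarith

open Classical in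
theorem sum_one {n : ℕ} (T : TypeBTableau n) (x : ℕ) :
    ∑ p : {p // Valid T p}, (if (extn T p.1 p.2).filling (Fin.last n) (Fin.last n) = true then
      x ^ (extn T p.1 p.2).U.card else 0) = x * (1 + x) ^ T.U.card := by
  classical
  have := sum_valid T (fun S => if S.filling (Fin.last n) (Fin.last n) = true then
      x ^ S.U.card else 0) (fun p => match p with
    | (false, _, _) => 0
    | (true, true, A) => x ^ (A.card + 1)
    | (true, false, A) => 0) (by
      rintro ⟨b, d, A⟩ hp
      cases b
      · have := (hp.2.1 rfl).1
        simp at this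
        simp [extn, this]
      · cases d
        · simp [extn]
        · simp [card_U_1]
          intro h; simp [extn] at h)
  simp only at this
  refine this.trans ?_
  have h3 : ∑ A ∈ T.U.powerset, x ^ (A.card + 1) = x * (1 + x) ^ T.U.card := by
    have := Finset.sum_pow_mul_eq_add_pow x 1 T.U
    simp only [one_pow, mul_one] at this
    simp only [pow_succ', ← Finset.mul_sum, this, add_comm]
  simp [h3]

theorem main (n : ℕ) (i : Fin n) (x : ℕ) :
    2 * ∑ T : TypeBTableau n, (if T.filling i i = true then x ^ T.U.card else 0)
      = ∑ T : TypeBTableau n, x ^ T.U.card := by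
  classical
  induction n generalizing x with
  | zero => exact i.elim0
  | succ n ih =>
    rw [sum_ext, sum_ext]
    simp only [sum_all]
    induction i using Fin.lastCases with
    | last =>
      simp only [sum_one]
      rw [Finset.mul_sum]
      exact Finset.sum_congr rfl fun _ _ => by ring
    | cast i =>
      have : ∀ T : TypeBTableau n, ∑ p : {p // Valid T p},
          (if (extn T p.1 p.2).filling i.castSucc i.castSucc = true then
            x ^ (extn T p.1 p.2).U.card else 0) =
          2 * x * (if T.filling i i = true then (1 + x) ^ T.U.card else 0) := by
        intro T
        have h : ∀ p : {p // Valid T p},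
          (extn T p.1 p.2).filling i.castSucc i.castSucc = T.filling i i := by
          intro p; simp [extn]
        simp only [h]
        split_ifs
        · rw [sum_all]
        · simp
      simp only [this]
      rw [← Finset.mul_sum, ← Finset.mul_sum, ← ih i (1 + x)]
      ring

end TypeBTableau

/-- The number of type-B permutation tableaux of size `n` whose `k`-th border step
is a west step and whose diagonal cell in the column of that west step contains a 1
equals `|B_n| / 2`.  (The diagonal cell of the column of west step `k` is the cell
`(⟨k-1⟩, ⟨k-1⟩)` in our encoding.) -/
theorem expected_diagonal_one_at_step (n k : ℕ) (hn : 1 ≤ n) (hk : 1 ≤ k) (hkn : k ≤ n) :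
    ((Finset.univ.filter (fun T : TypeBTableau n =>
        T.west ⟨k - 1, by omega⟩ = true ∧
        T.filling ⟨k - 1, by omega⟩ ⟨k - 1, by omega⟩ = true)).card : ℝ) =
      (Fintype.card (TypeBTableau n) : ℝ) / 2 := by
  have h := TypeBTableau.main n ⟨k - 1, by omega⟩ 1
  simp only [one_pow, Finset.sum_const, Finset.card_univ, smul_eq_mul, mul_one] at h
  rw [← Finset.card_filter] at h
  rw [← h]
  push_cast
  rw [mul_div_cancel_left₀ _ (by norm_num)]
  congr 2
  ext T
  simp only [Finset.mem_filter, Finset.mem_univ, true_and]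
  exact ⟨fun h => h.2, fun h => ⟨(T.support _ _ h).1, h⟩⟩
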